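/- arXiv:2305.05963 — 4 statements merged into one kernel-verified Lean document; each statement's English description precedes it below -/
import Mathlib

section
/- Let n, r, K be positive integers with r ≤ n, and let R_1, …, R_K be real n×n positive semidefinite matrices. For every real n×r matrix U satisfying Uᵀ U ⪯ I_r (i.e., I_r − Uᵀ U is positive semidefinite), there exists a real n×r matrix V with Vᵀ V = I_r such that Tr(Vᵀ R_k V) ≥ Tr(Uᵀ R_k U) for every k ∈ {1, …, K}. -/
open Matrix

/-- A tall matrix with orthogonal columns is a semi-orthogonal matrix with rescaled columns. -/
theorem exists_semiorthogonal_mul_diagonal {n r : ℕ} (hrn : r ≤ n)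
    (W : Matrix (Fin n) (Fin r) ℝ) (hW : (Wᵀ * W).IsDiag) :
    ∃ (V : Matrix (Fin n) (Fin r) ℝ) (c : Fin r → ℝ), Vᵀ * V = 1 ∧ W = V * diagonal c := by
  let w : Fin r → EuclideanSpace ℝ (Fin n) := fun i ↦ WithLp.toLp 2 (W.col i)
  let f : Fin n → EuclideanSpace ℝ (Fin n) := Function.extend (Fin.castLE hrn) w 0
  have hf_cast (i) : f (Fin.castLE hrn i) = w i := (Fin.castLE_injective hrn).extend_apply _ _ _
  have hw : Pairwise fun i j ↦ inner ℝ (w i) (w j) = 0 := fun i j hij ↦ by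
    simpa [w, EuclideanSpace.inner_eq_star_dotProduct, mul_apply, dotProduct] using hW hij.symm
  have hf : Pairwise fun i j ↦ inner ℝ (f i) (f j) = 0 := fun i j hij ↦ by
    by_cases hi : ∃ k, Fin.castLE hrn k = i
    · by_cases hj : ∃ k, Fin.castLE hrn k = j
      · obtain ⟨k, rfl⟩ := hi
        obtain ⟨l, rfl⟩ := hj
        rw [hf_cast, hf_cast]
        exact hw fun h ↦ hij (congrArg _ h)
      · simp [f, Function.extend_apply' _ _ _ hj]
    · simp [f, Function.extend_apply' _ _ _ hi]
  have hcard : Module.finrank ℝ (EuclideanSpace ℝ (Fin n)) = Fintype.card (Fin n) := by simp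
  let b := InnerProductSpace.gramSchmidtOrthonormalBasis hcard f
  have hb (i) : w i = ‖w i‖ • b (Fin.castLE hrn i) := by
    by_cases hi : w i = 0
    · simp [hi]
    · have := InnerProductSpace.gramSchmidtOrthonormalBasis_apply_of_orthogonal hcard hf
        (i := Fin.castLE hrn i) (by rwa [hf_cast])
      rw [hf_cast] at this
      simp [b, this, smul_smul, norm_ne_zero_iff.mpr hi]
  refine ⟨of fun a i ↦ b (Fin.castLE hrn i) a, fun i ↦ ‖w i‖, ?_, ?_⟩
  · ext i j
    have := orthonormal_iff_ite.mp b.orthonormal (Fin.castLE hrn i) (Fin.castLE hrn j)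
    simp only [PiLp.inner_apply, Fin.castLE_inj] at this
    simpa [mul_apply, one_apply, mul_comm] using this
  · ext a i
    have := congrArg (fun x : EuclideanSpace ℝ (Fin n) ↦ x a) (hb i)
    simpa [w, mul_comm] using this

/-- relaxing the semi-orthogonality constraint `Uᵀ U = I` to
`Uᵀ U ⪯ I` does not decrease the objectives: for any `U` with `Uᵀ U ⪯ I` there is a
semi-orthogonal `V` with `Tr(Vᵀ R_k V) ≥ Tr(Uᵀ R_k U)` for all `k`. -/
theorem fpca_relaxation_pointwise
    (n r K : ℕ) (hn : 0 < n) (hr : 0 < r) (hK : 0 < K) (hrn : r ≤ n)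
    (R : Fin K → Matrix (Fin n) (Fin n) ℝ) (hR : ∀ k, (R k).PosSemidef)
    (U : Matrix (Fin n) (Fin r) ℝ) (hU : ((1 : Matrix (Fin r) (Fin r) ℝ) - Uᵀ * U).PosSemidef) :
    ∃ V : Matrix (Fin n) (Fin r) ℝ, Vᵀ * V = 1 ∧
      ∀ k : Fin K, (Uᵀ * R k * U).trace ≤ (Vᵀ * R k * V).trace := by
  have hA : (Uᵀ * U).IsHermitian := by
    simpa using isHermitian_conjTranspose_mul_self U
  obtain ⟨Q, hQ, hQ', hdiag⟩ : ∃ Q : Matrix (Fin r) (Fin r) ℝ,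
      Qᵀ * Q = 1 ∧ Q * Qᵀ = 1 ∧ ((U * Q)ᵀ * (U * Q)).IsDiag := by
    refine ⟨hA.eigenvectorUnitary, ?_, ?_, ?_⟩
    · simpa [star_eq_conjTranspose] using Unitary.coe_star_mul_self hA.eigenvectorUnitary
    · simpa [star_eq_conjTranspose] using Unitary.coe_mul_star_self hA.eigenvectorUnitary
    · have := hA.conjStarAlgAut_star_eigenvectorUnitary
      simp only [Unitary.conjStarAlgAut_apply, Unitary.coe_star, star_eq_conjTranspose,
        conjTranspose_eq_transpose_of_trivial, transpose_transpose] at this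
      rw [transpose_mul, Matrix.mul_assoc, ← Matrix.mul_assoc Uᵀ, ← Matrix.mul_assoc, this]
      exact isDiag_diagonal _
  obtain ⟨V, c, hV, hUQ⟩ := exists_semiorthogonal_mul_diagonal hrn (U * Q) hdiag
  have hc (i) : c i * c i ≤ 1 := by
    have hgram : Qᵀ * (1 - Uᵀ * U) * Q = 1 - diagonal (fun i ↦ c i * c i) := by
      calc Qᵀ * (1 - Uᵀ * U) * Q = Qᵀ * Q - (U * Q)ᵀ * (U * Q) := by
            simp only [Matrix.mul_sub, Matrix.sub_mul, Matrix.mul_one, transpose_mul,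
              Matrix.mul_assoc]
        _ = Qᵀ * Q - diagonal c * (Vᵀ * V) * diagonal c := by
            rw [hUQ]
            simp only [transpose_mul, diagonal_transpose, Matrix.mul_assoc]
        _ = _ := by rw [hQ, hV, Matrix.mul_one, diagonal_mul_diagonal]
    have := (hU.conjTranspose_mul_mul_same Q).diag_nonneg (i := i)
    rw [conjTranspose_eq_transpose_of_trivial, hgram] at this
    simpa using this
  refine ⟨V, hV, fun k ↦ ?_⟩
  have hpos : (Vᵀ * R k * V).PosSemidef := by
    simpa using (hR k).conjTranspose_mul_mul_same V
  calc (Uᵀ * R k * U).trace = ((U * Q)ᵀ * R k * (U * Q)).trace := by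
        rw [transpose_mul, ← Matrix.mul_assoc, trace_mul_comm _ Q]
        simp only [← Matrix.mul_assoc, hQ', Matrix.one_mul]
    _ = (diagonal c * (Vᵀ * R k * V) * diagonal c).trace := by
        rw [hUQ]
        simp only [transpose_mul, diagonal_transpose, Matrix.mul_assoc]
    _ ≤ (Vᵀ * R k * V).trace := by
        refine Finset.sum_le_sum fun i _ ↦ ?_
        have := mul_le_mul_of_nonneg_right (hc i) (hpos.diag_nonneg (i := i))
        rw [diag_apply, diag_apply, mul_diagonal, diagonal_mul]
        linarith
end

section
/- Let n, r, K be positive integers with r ≤ n, and let R_1, …, R_K be real n×n positive semidefinite matrices. Then sup over {U ∈ ℝ^{n×r} : Uᵀ U ⪯ I_r} of min_{k ∈ {1,…,K}} Tr(Uᵀ R_k U) equals sup over {U ∈ ℝ^{n×r} : Uᵀ U = I_r} of min_{k ∈ {1,…,K}} Tr(Uᵀ R_k U). -/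
open Matrix

/-- A real matrix with pairwise orthogonal columns is a semi-orthogonal matrix with rescaled
columns, as soon as it has at least as many rows as columns. -/
theorem exists_semiorthogonal_mul_diagonal_s1 {m n : Type*} [Fintype m] [Fintype n] [DecidableEq n]
    (hcard : Fintype.card n ≤ Fintype.card m) (W : Matrix m n ℝ) (d : n → ℝ)
    (hW : Wᵀ * W = diagonal d) :
    ∃ V : Matrix m n ℝ, Vᵀ * V = 1 ∧ W = V * diagonal (fun i => √(d i)) := by
  classical
  obtain ⟨f⟩ := Function.Embedding.nonempty_of_card_le hcard
  have hin (x y : EuclideanSpace ℝ m) : inner ℝ x y = ∑ a, x a * y a := by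
    simp [PiLp.inner_apply, mul_comm]
  have hsum (i j : n) : ∑ a, W a i * W a j = diagonal d i j := by
    rw [← hW, mul_apply]; rfl
  have hd (i : n) : ∑ a, W a i * W a i = d i := by simpa using hsum i i
  have hd0 (i : n) : 0 ≤ d i := by
    rw [← hd]; exact Finset.sum_nonneg fun a _ => mul_self_nonneg _
  let u : n → EuclideanSpace ℝ m := fun i => WithLp.toLp 2 fun a => (√(d i))⁻¹ * W a i
  have hu (i j : n) : inner ℝ (u i) (u j) = (√(d i))⁻¹ * (√(d j))⁻¹ * diagonal d i j := by
    rw [hin, ← hsum, Finset.mul_sum]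
    exact Finset.sum_congr rfl fun a _ => by simp only [u]; ring
  have horth : Orthonormal ℝ ((f '' {i | d i ≠ 0}).domRestrict (Function.extend f u 0)) := by
    rw [orthonormal_iff_ite]
    rintro ⟨x, hx⟩ ⟨y, hy⟩
    obtain ⟨i, hi, rfl⟩ := (Set.mem_image ..).1 hx
    obtain ⟨j, -, rfl⟩ := (Set.mem_image ..).1 hy
    simp only [Set.domRestrict_apply, f.injective.extend_apply, hu, Subtype.mk.injEq,
      f.injective.eq_iff]
    by_cases hij : i = j
    · subst hij
      have h : √(d i) ≠ 0 := (Real.sqrt_pos.2 (lt_of_le_of_ne (hd0 i) (Ne.symm hi))).ne'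
      have h' := Real.mul_self_sqrt (hd0 i)
      simp only [diagonal_apply_eq, if_true]
      field_simp
      nlinarith
    · simp [hij]
  obtain ⟨b, hb⟩ := horth.exists_orthonormalBasis_extension_of_card_eq (by simp)
  refine ⟨of fun a i => b (f i) a, ?_, ?_⟩
  · ext i j
    have h := orthonormal_iff_ite.1 b.orthonormal (f i) (f j)
    rw [hin] at h
    simpa [mul_apply, one_apply, f.injective.eq_iff] using h
  · ext a i
    rw [mul_diagonal]
    by_cases hi : d i = 0
    · have h := hd i
      rw [hi, Finset.sum_eq_zero_iff_of_nonneg fun a _ => mul_self_nonneg _] at h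
      simpa [hi] using h a (Finset.mem_univ a)
    · have h : √(d i) ≠ 0 := (Real.sqrt_pos.2 (lt_of_le_of_ne (hd0 i) (Ne.symm hi))).ne'
      have hbi := hb (f i) ⟨i, hi, rfl⟩
      rw [f.injective.extend_apply] at hbi
      simp only [of_apply, hbi, u]
      field_simp

/-- Every matrix `U` with `Uᵀ U ⪯ 1` is dominated by a semi-orthogonal matrix `V`, simultaneously
for all the functionals `Tr(Uᵀ R U)` with `R` positive semidefinite. -/
theorem exists_semiorthogonal_trace_le {m n : Type*} [Fintype m] [Fintype n] [DecidableEq n]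
    (hcard : Fintype.card n ≤ Fintype.card m) (U : Matrix m n ℝ)
    (hU : ((1 : Matrix n n ℝ) - Uᵀ * U).PosSemidef) :
    ∃ V : Matrix m n ℝ, Vᵀ * V = 1 ∧ ∀ R : Matrix m m ℝ, R.PosSemidef →
      (Uᵀ * R * U).trace ≤ (Vᵀ * R * V).trace := by
  have hA : (Uᵀ * U).IsHermitian := by
    simpa using isHermitian_conjTranspose_mul_self U
  let Q : Matrix n n ℝ := hA.eigenvectorUnitary
  let d := hA.eigenvalues
  have hQ : Qᵀ * Q = 1 := by
    simpa [star_eq_conjTranspose] using Unitary.coe_star_mul_self hA.eigenvectorUnitary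
  have hQ' : Q * Qᵀ = 1 := mul_eq_one_comm.1 hQ
  have hdiag : (U * Q)ᵀ * (U * Q) = diagonal d := by
    have h := hA.spectral_theorem
    rw [Unitary.conjStarAlgAut_apply] at h
    have h' : Uᵀ * U = Q * diagonal d * Qᵀ := by
      simpa [star_eq_conjTranspose, Function.comp_def] using h
    calc (U * Q)ᵀ * (U * Q) = Qᵀ * (Uᵀ * U) * Q := by simp only [transpose_mul, Matrix.mul_assoc]
      _ = (Qᵀ * Q) * diagonal d * (Qᵀ * Q) := by rw [h']; simp only [Matrix.mul_assoc]
      _ = diagonal d := by rw [hQ]; simp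
  have hd (i : n) : d i ≤ 1 := by
    have h := (hU.conjTranspose_mul_mul_same Q).diag_nonneg (i := i)
    have h' : Qᴴ * (1 - Uᵀ * U) * Q = 1 - diagonal d := by
      rw [← hdiag, conjTranspose_eq_transpose_of_trivial, Matrix.mul_sub, Matrix.sub_mul,
        Matrix.mul_one, hQ]
      simp only [transpose_mul, Matrix.mul_assoc]
    rw [h'] at h
    simpa using h
  obtain ⟨V, hV, hW⟩ := exists_semiorthogonal_mul_diagonal_s1 hcard (U * Q) d hdiag
  have hd0 (i : n) : 0 ≤ d i := by
    have h := congrFun (congrFun hdiag i) i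
    rw [diagonal_apply_eq] at h
    rw [← h, mul_apply]
    exact Finset.sum_nonneg fun a _ => mul_self_nonneg _
  refine ⟨V, hV, fun R hR => ?_⟩
  have hVR : (Vᵀ * R * V).PosSemidef := by simpa using hR.conjTranspose_mul_mul_same V
  calc (Uᵀ * R * U).trace = ((Uᵀ * R * U) * (Q * Qᵀ)).trace := by rw [hQ', Matrix.mul_one]
    _ = ((U * Q)ᵀ * R * (U * Q)).trace := by
      rw [← Matrix.mul_assoc, trace_mul_comm]
      simp only [transpose_mul, Matrix.mul_assoc]
    _ = (diagonal (fun i => √(d i)) * (Vᵀ * R * V) * diagonal (fun i => √(d i))).trace := by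
      rw [hW]
      simp only [transpose_mul, diagonal_transpose, Matrix.mul_assoc]
    _ = ∑ i, d i * (Vᵀ * R * V) i i := by
      refine Finset.sum_congr rfl fun i _ => ?_
      rw [diag_apply, mul_diagonal, diagonal_mul, mul_right_comm, Real.mul_self_sqrt (hd0 i)]
    _ ≤ (Vᵀ * R * V).trace :=
      Finset.sum_le_sum fun i _ => mul_le_of_le_one_left hVR.diag_nonneg (hd i)

/-- the optimal value of the fair PCA problem over semi-orthogonal
matrices `Uᵀ U = I` equals the optimal value over the relaxed set `Uᵀ U ⪯ I`. -/
theorem fpca_relaxation_value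
    (n r K : ℕ) (hn : 0 < n) (hr : 0 < r) (hK : 0 < K) (hrn : r ≤ n)
    (R : Fin K → Matrix (Fin n) (Fin n) ℝ) (hR : ∀ k, (R k).PosSemidef) :
    sSup {v : ℝ | ∃ U : Matrix (Fin n) (Fin r) ℝ,
        ((1 : Matrix (Fin r) (Fin r) ℝ) - Uᵀ * U).PosSemidef ∧
        v = ⨅ k : Fin K, (Uᵀ * R k * U).trace}
      =
    sSup {v : ℝ | ∃ U : Matrix (Fin n) (Fin r) ℝ,
        Uᵀ * U = 1 ∧
        v = ⨅ k : Fin K, (Uᵀ * R k * U).trace} := by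
  apply csSup_eq_csSup_of_forall_exists_le
  · rintro _ ⟨U, hU, rfl⟩
    obtain ⟨V, hV, h⟩ := exists_semiorthogonal_trace_le (by simpa using hrn) U hU
    exact ⟨_, ⟨V, hV, rfl⟩, ciInf_mono (Set.finite_range _).bddBelow fun k => h _ (hR k)⟩
  · rintro _ ⟨U, hU, rfl⟩
    exact ⟨_, ⟨U, by rw [hU, sub_self]; exact PosSemidef.zero, rfl⟩, le_rfl⟩
end

section
/- Let M ∈ ℝ^{r×r} be positive definite. Then for every positive definite Φ ∈ ℝ^{r×r}, Tr(Φ^{−1}) + Tr(M Φ) ≥ 2 Tr(M^{1/2}), and equality holds for Φ = M^{−1/2} (the inverse of the positive definite square root of M). -/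
open Matrix

/-- variational characterization of the nuclear norm term:
for positive definite `M` with positive definite square root `S`,
`Tr(Φ⁻¹) + Tr(M Φ) ≥ 2 Tr(M^{1/2})` for all `Φ ≻ 0`, with equality at `Φ = M^{-1/2}`. -/
theorem trace_inv_add_trace_mul_ge
    (r : ℕ) (M : Matrix (Fin r) (Fin r) ℝ) (hM : M.PosDef)
    (S : Matrix (Fin r) (Fin r) ℝ) (hS : S.PosDef) (hSS : S * S = M) :
    (∀ Φ : Matrix (Fin r) (Fin r) ℝ, Φ.PosDef →
        2 * S.trace ≤ (Φ⁻¹).trace + (M * Φ).trace) ∧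
      ((S⁻¹)⁻¹).trace + (M * S⁻¹).trace = 2 * S.trace := by
  subst hSS
  have hSdet : IsUnit S.det := (isUnit_iff_isUnit_det S).mp hS.isUnit
  refine ⟨fun Φ hΦ ↦ ?_, ?_⟩
  · have hΦdet : IsUnit Φ.det := (isUnit_iff_isUnit_det Φ).mp hΦ.isUnit
    have hsymm : (S - Φ⁻¹)ᴴ = S - Φ⁻¹ := (hS.isHermitian.sub hΦ.isHermitian.inv).eq
    have hnonneg := (hΦ.posSemidef.conjTranspose_mul_mul_same (S - Φ⁻¹)).trace_nonneg
    have hexpand : (S - Φ⁻¹) * Φ * (S - Φ⁻¹) = S * Φ * S - S - (S - Φ⁻¹) := by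
      rw [sub_mul, nonsing_inv_mul Φ hΦdet, sub_mul, mul_sub, one_mul,
        mul_nonsing_inv_cancel_right Φ S hΦdet]
    rw [hsymm, hexpand, trace_sub, trace_sub, trace_sub, trace_mul_cycle] at hnonneg
    linarith
  · rw [nonsing_inv_nonsing_inv S hSdet, mul_nonsing_inv_cancel_right S S hSdet]
    ring
end

section
/- Let n, r, K be positive integers, let A_1, …, A_K ∈ ℝ^{n×r}, and let c ∈ ℝ^K. Then the supremum over {U ∈ ℝ^{n×r} : Uᵀ U ⪯ I_r} of min_{k ∈ {1,…,K}} (2 Tr(A_kᵀ U) + c_k) equals the infimum over μ in the simplex Δ = {μ ∈ ℝ^K : μ_k ≥ 0, Σ_k μ_k = 1} of 2 Tr((A(μ)ᵀ A(μ))^{1/2}) + Σ_{k=1}^K μ_k c_k, where A(μ) = Σ_{k=1}^K μ_k A_k and (A(μ)ᵀ A(μ))^{1/2} denotes the positive semidefinite square root of A(μ)ᵀ A(μ). -/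
open Matrix

lemma Matrix.PosSemidef.trace_mul_nonneg {m : Type*} [Fintype m] [DecidableEq m]
    {S X : Matrix m m ℝ} (hS : S.PosSemidef) (hX : X.PosSemidef) : 0 ≤ (S * X).trace := by
  open scoped MatrixOrder in
  obtain ⟨B, rfl⟩ := CStarAlgebra.nonneg_iff_eq_star_mul_self.mp hX.nonneg
  have h := (hS.mul_mul_conjTranspose_same B).trace_nonneg
  rwa [Matrix.mul_assoc, Matrix.trace_mul_comm, Matrix.mul_assoc, ← star_eq_conjTranspose] at h

lemma Matrix.PosSemidef.trace_mul_le_trace {m : Type*} [Fintype m] [DecidableEq m]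
    {S X : Matrix m m ℝ} (hS : S.PosSemidef) (hX : (1 - X).PosSemidef) :
    (S * X).trace ≤ S.trace := by
  have h := hS.trace_mul_nonneg hX
  rw [Matrix.mul_sub, Matrix.mul_one, Matrix.trace_sub] at h
  linarith

/-- The regularized polar factor `M (S + ε)⁻¹` of a matrix `M` with `Mᵀ M = S²` is a contraction,
and it recovers `M` upon multiplication by `S + ε`. -/
lemma exists_contraction_mul_add_smul_one {m n : Type*} [Fintype m] [DecidableEq m] [Fintype n]
    {M : Matrix n m ℝ} {S : Matrix m m ℝ} (hS : S.PosSemidef) (hSM : S * S = Mᵀ * M)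
    {ε : ℝ} (hε : 0 < ε) :
    ∃ W : Matrix n m ℝ, (1 - Wᵀ * W).PosSemidef ∧ M = W * (S + ε • (1 : Matrix m m ℝ)) := by
  set T := S + ε • (1 : Matrix m m ℝ) with hT
  have hTpos : T.PosDef := Matrix.PosDef.posSemidef_add hS (Matrix.PosDef.one.smul hε)
  have hdet : IsUnit T.det := hTpos.det_pos.ne'.isUnit
  have hTt : Tᵀ = T := hTpos.isHermitian
  refine ⟨M * T⁻¹, ?_, by rw [Matrix.mul_assoc, Matrix.nonsing_inv_mul _ hdet, Matrix.mul_one]⟩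
  have hgap : T * T - S * S = (2 * ε) • S + (ε * ε) • (1 : Matrix m m ℝ) := by
    rw [hT]
    simp only [Matrix.mul_add, Matrix.add_mul, Matrix.mul_smul, Matrix.smul_mul, Matrix.mul_one,
      Matrix.one_mul]
    module
  have hpsd : (T * T - S * S).PosSemidef := by
    rw [hgap]
    exact (hS.smul (by positivity)).add (Matrix.PosSemidef.one.smul (by positivity))
  have hconj := hpsd.conjTranspose_mul_mul_same T⁻¹
  have hinv : (T⁻¹)ᴴ = T⁻¹ := hTpos.isHermitian.inv
  have hinv' : (T⁻¹)ᵀ = T⁻¹ := hinv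
  convert hconj using 1
  rw [hinv, Matrix.mul_sub, Matrix.sub_mul, hSM, Matrix.transpose_mul, hinv',
    ← Matrix.mul_assoc T⁻¹ T T, Matrix.nonsing_inv_mul _ hdet, Matrix.one_mul,
    Matrix.mul_nonsing_inv _ hdet]
  simp only [Matrix.mul_assoc]

lemma trace_transpose_mul_le_trace_of_contraction {m n : Type*} [Fintype m] [DecidableEq m]
    [Fintype n] {M U : Matrix n m ℝ} {S : Matrix m m ℝ} (hS : S.PosSemidef)
    (hSM : S * S = Mᵀ * M) (hU : (1 - Uᵀ * U).PosSemidef) : (Mᵀ * U).trace ≤ S.trace := by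
  have key : ∀ ε : ℝ, 0 < ε → (Mᵀ * U).trace ≤ S.trace + ε * (Fintype.card m : ℝ) := by
    intro ε hε
    obtain ⟨W, hW, hMW⟩ := exists_contraction_mul_add_smul_one hS hSM hε
    set T := S + ε • (1 : Matrix m m ℝ) with hT
    have hTpsd : T.PosSemidef := hS.add (Matrix.PosSemidef.one.smul hε.le)
    have hTt : Tᵀ = T := hTpsd.isHermitian
    have htr : T.trace = S.trace + ε * (Fintype.card m : ℝ) := by
      simp [hT, Matrix.trace_add, Matrix.trace_smul]
    have h₁ := hTpsd.trace_mul_le_trace hU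
    have h₂ := hTpsd.trace_mul_le_trace hW
    have h₃ : 0 ≤ (T * ((W - U)ᵀ * (W - U))).trace :=
      hTpsd.trace_mul_nonneg (Matrix.posSemidef_conjTranspose_mul_self (W - U))
    have h₄ : (T * (Uᵀ * W)).trace = (T * (Wᵀ * U)).trace := by
      rw [← Matrix.trace_transpose, Matrix.transpose_mul, Matrix.transpose_mul,
        Matrix.transpose_transpose, hTt, Matrix.trace_mul_comm]
    have h₅ : Mᵀ * U = T * (Wᵀ * U) := by
      rw [hMW, Matrix.transpose_mul, hTt, Matrix.mul_assoc]
    simp only [Matrix.transpose_sub, Matrix.mul_sub, Matrix.sub_mul, Matrix.trace_sub] at h₃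
    rw [h₅, ← htr]
    linarith
  refine le_of_forall_pos_le_add fun δ hδ => ?_
  have hc : (0 : ℝ) < (Fintype.card m : ℝ) + 1 := by positivity
  refine (key (δ / ((Fintype.card m : ℝ) + 1)) (by positivity)).trans ?_
  gcongr
  rw [div_mul_eq_mul_div, div_le_iff₀ hc]
  nlinarith

lemma exists_contraction_trace_sub_lt {m n : Type*} [Fintype m] [DecidableEq m]
    [Fintype n] {M : Matrix n m ℝ} {S : Matrix m m ℝ} (hS : S.PosSemidef)
    (hSM : S * S = Mᵀ * M) {δ : ℝ} (hδ : 0 < δ) :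
    ∃ U : Matrix n m ℝ, (1 - Uᵀ * U).PosSemidef ∧ S.trace - δ < (Mᵀ * U).trace := by
  have hc : (0 : ℝ) < (Fintype.card m : ℝ) + 1 := by positivity
  set ε := δ / ((Fintype.card m : ℝ) + 1) with hε_def
  have hε : 0 < ε := by positivity
  obtain ⟨W, hW, hMW⟩ := exists_contraction_mul_add_smul_one hS hSM hε
  refine ⟨W, hW, ?_⟩
  set T := S + ε • (1 : Matrix m m ℝ) with hT
  have hTpos : T.PosDef := Matrix.PosDef.posSemidef_add hS (Matrix.PosDef.one.smul hε)
  have hTt : Tᵀ = T := hTpos.isHermitian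
  have hdet : IsUnit T.det := hTpos.det_pos.ne'.isUnit
  -- `S² = T (Wᵀ W) T`, whence `tr (T Wᵀ W) = tr (S² T⁻¹) = tr S - ε tr (S T⁻¹)`.
  have hST : S = T - ε • 1 := by rw [hT]; abel
  have hgram : Mᵀ * W * T = S * S := by rw [Matrix.mul_assoc, ← hMW, hSM]
  have hMW' : Mᵀ * W = S * S * T⁻¹ := by
    rw [← hgram, Matrix.mul_assoc, Matrix.mul_nonsing_inv _ hdet, Matrix.mul_one]
  have hexp : S * S * T⁻¹ = T - (2 * ε) • (1 : Matrix m m ℝ) + (ε * ε) • T⁻¹ := by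
    rw [hST]
    simp only [Matrix.mul_sub, Matrix.sub_mul, Matrix.mul_smul, Matrix.smul_mul, Matrix.mul_one,
      Matrix.one_mul, Matrix.mul_assoc, Matrix.mul_nonsing_inv _ hdet]
    module
  have hinv : 0 ≤ (T⁻¹).trace := hTpos.inv.posSemidef.trace_nonneg
  have hcard : ε * ((Fintype.card m : ℝ) + 1) = δ := by
    rw [hε_def]; field_simp
  have : (Mᵀ * W).trace = S.trace - ε * (Fintype.card m : ℝ) + ε * ε * (T⁻¹).trace := by
    rw [hMW', hexp, hT]
    simp [Matrix.trace_add, Matrix.trace_sub, Matrix.trace_smul]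
    ring
  rw [this]
  nlinarith [mul_nonneg (mul_nonneg hε.le hε.le) hinv]

lemma convex_setOf_contraction {m n : Type*} [Fintype m] [DecidableEq m] [Fintype n] :
    Convex ℝ {U : Matrix n m ℝ | (1 - Uᵀ * U).PosSemidef} := by
  intro U hU V hV a b ha hb hab
  have h := ((hU.smul ha).add (hV.smul hb)).add
    ((Matrix.posSemidef_conjTranspose_mul_self (U - V)).smul (mul_nonneg ha hb))
  rw [Set.mem_ofPred_eq]
  convert h using 1
  have hb' : b = 1 - a := by linarith
  subst hb'
  simp only [Matrix.conjTranspose_eq_transpose_of_trivial, Matrix.transpose_add,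
    Matrix.transpose_sub, Matrix.transpose_smul, Matrix.mul_sub, Matrix.sub_mul, Matrix.mul_add,
    Matrix.add_mul, Matrix.mul_smul, Matrix.smul_mul]
  module

/-- A theorem of the alternative: if no point of a nonempty convex set of `ι → ℝ` has all
coordinates above `v`, some convex combination of the coordinates is at most `v` on that set. -/
lemma Convex.exists_simplex_sum_mul_le {ι : Type*} [Fintype ι] [DecidableEq ι]
    {t : Set (ι → ℝ)} (ht : Convex ℝ t) (hne : t.Nonempty) {v : ℝ}
    (hv : ∀ y ∈ t, ∃ k, y k ≤ v) :
    ∃ μ : ι → ℝ, (∀ k, 0 ≤ μ k) ∧ ∑ k, μ k = 1 ∧ ∀ y ∈ t, ∑ k, μ k * y k ≤ v := by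
  have hsc : Convex ℝ (Set.univ.pi fun _ : ι => Set.Ioi v) :=
    convex_pi fun _ _ => convex_Ioi v
  have hso : IsOpen (Set.univ.pi fun _ : ι => Set.Ioi v) :=
    isOpen_set_pi Set.finite_univ fun _ _ => isOpen_Ioi
  have hdisj : Disjoint (Set.univ.pi fun _ : ι => Set.Ioi v) t := by
    rw [Set.disjoint_left]
    intro y hy hyt
    obtain ⟨k, hk⟩ := hv y hyt
    exact absurd (hy k (Set.mem_univ k)) (not_lt.mpr hk)
  obtain ⟨f, u, hfs, hft⟩ := geometric_hahn_banach_open hsc hso ht hdisj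
  have hrep : ∀ y : ι → ℝ, f y = ∑ k, y k * f (Pi.single k 1) := by
    intro y
    conv_lhs => rw [pi_eq_sum_univ' y, map_sum]
    simp
  have hsign : ∀ k, f (Pi.single k 1) ≤ 0 := by
    intro k
    by_contra! hpos
    have hbase : ∀ N : ℝ, 0 ≤ N → f (fun _ => v + 1) + N * f (Pi.single k 1) < u := by
      intro N hN
      have := hfs ((fun _ => v + 1) + N • Pi.single k 1) (by
        intro j _
        have : 0 ≤ N * (Pi.single k (1 : ℝ) : ι → ℝ) j := by
          refine mul_nonneg hN ?_
          rw [Pi.single_apply]; split_ifs <;> norm_num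
        simp only [Pi.add_apply, Pi.smul_apply, smul_eq_mul, Set.mem_Ioi]
        linarith)
      simpa using this
    have h₀ := hbase 0 le_rfl
    have h₁ := hbase ((u - f (fun _ => v + 1)) / f (Pi.single k 1))
      (div_nonneg (by linarith) hpos.le)
    rw [div_mul_cancel₀ _ hpos.ne'] at h₁
    linarith
  have hconst : ∀ a : ℝ, f (fun _ => a) = a * ∑ k, f (Pi.single k 1) := by
    intro a; rw [hrep, Finset.mul_sum]
  have hsum : ∑ k, f (Pi.single k 1) < 0 := by
    refine lt_of_le_of_ne (Finset.sum_nonpos fun k _ => hsign k) fun h0 => ?_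
    have hzero := (Finset.sum_eq_zero_iff_of_nonpos fun k _ => hsign k).mp h0
    obtain ⟨y, hy⟩ := hne
    have h₁ := hfs (fun _ => v + 1) (fun _ _ => by simp)
    have h₂ := hft y hy
    rw [hconst, h0, mul_zero] at h₁
    rw [hrep, Finset.sum_eq_zero fun k hk => by rw [hzero k hk, mul_zero]] at h₂
    linarith
  set s := ∑ k, f (Pi.single k 1) with hs
  refine ⟨fun k => f (Pi.single k 1) / s, fun k => div_nonneg_of_nonpos (hsign k) hsum.le,
    by rw [← Finset.sum_div, div_self hsum.ne], fun y hy => ?_⟩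
  have hvs : v * s ≤ f y := by
    refine le_of_forall_pos_le_add fun δ hδ => ?_
    have h₁ := hfs (fun _ => v + δ / (-s)) (fun _ _ => by
      have : 0 < δ / (-s) := div_pos hδ (by linarith)
      simpa using this)
    have h₂ := hft y hy
    have h₃ : δ / (-s) * s = -δ := by field_simp [hsum.ne]
    rw [hconst, add_mul, h₃] at h₁
    linarith
  have : ∑ k, f (Pi.single k 1) / s * y k = f y / s := by
    rw [hrep y, Finset.sum_div]
    exact Finset.sum_congr rfl fun k _ => by ring
  rw [this, div_le_iff_of_neg hsum]
  exact hvs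

lemma sum_mul_trace_add {n r K : ℕ} (A : Fin K → Matrix (Fin n) (Fin r) ℝ) (c μ : Fin K → ℝ)
    (U : Matrix (Fin n) (Fin r) ℝ) :
    ∑ k, μ k * (2 * ((A k)ᵀ * U).trace + c k) =
      2 * ((∑ k, μ k • A k)ᵀ * U).trace + ∑ k, μ k * c k := by
  rw [Matrix.transpose_sum, Matrix.sum_mul, Matrix.trace_sum, Finset.mul_sum,
    ← Finset.sum_add_distrib]
  refine Finset.sum_congr rfl fun k _ => ?_
  rw [Matrix.transpose_smul, Matrix.smul_mul, Matrix.trace_smul, smul_eq_mul]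
  ring

lemma exists_posSemidef_mul_self_eq {m n : Type*} [Fintype m] [DecidableEq m] [Fintype n]
    (M : Matrix n m ℝ) : ∃ S : Matrix m m ℝ, S.PosSemidef ∧ S * S = Mᵀ * M := by
  open scoped MatrixOrder in
  have h : (0 : Matrix m m ℝ) ≤ Mᵀ * M := (Matrix.posSemidef_conjTranspose_mul_self M).nonneg
  exact ⟨CFC.sqrt (Mᵀ * M), (CFC.sqrt_nonneg _).posSemidef, CFC.sqrt_mul_sqrt_self _ h⟩

/-- dual reformulation of the FPCA surrogate problem:
`sup_{Uᵀ U ⪯ I} min_k (2 Tr(A_kᵀ U) + c_k)`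
`= inf_{μ ∈ Δ} 2 Tr((A(μ)ᵀ A(μ))^{1/2}) + Σ_k μ_k c_k`, where `A(μ) = Σ_k μ_k A_k`
and the square root is encoded by the (unique) positive semidefinite `S` with
`S * S = A(μ)ᵀ A(μ)`. -/
theorem fpca_dual_reformulation
    (n r K : ℕ) (hn : 0 < n) (hr : 0 < r) (hK : 0 < K)
    (A : Fin K → Matrix (Fin n) (Fin r) ℝ) (c : Fin K → ℝ) :
    sSup {v : ℝ | ∃ U : Matrix (Fin n) (Fin r) ℝ,
        ((1 : Matrix (Fin r) (Fin r) ℝ) - Uᵀ * U).PosSemidef ∧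
        v = ⨅ k : Fin K, (2 * ((A k)ᵀ * U).trace + c k)}
      =
    sInf {w : ℝ | ∃ (μ : Fin K → ℝ) (S : Matrix (Fin r) (Fin r) ℝ),
        (∀ k, 0 ≤ μ k) ∧ (∑ k, μ k = 1) ∧ S.PosSemidef ∧
        S * S = (∑ k, μ k • A k)ᵀ * (∑ k, μ k • A k) ∧
        w = 2 * S.trace + ∑ k, μ k * c k} := by
  have : Nonempty (Fin K) := ⟨⟨0, hK⟩⟩
  set P := {v : ℝ | ∃ U : Matrix (Fin n) (Fin r) ℝ,
        ((1 : Matrix (Fin r) (Fin r) ℝ) - Uᵀ * U).PosSemidef ∧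
        v = ⨅ k : Fin K, (2 * ((A k)ᵀ * U).trace + c k)} with hP
  set D := {w : ℝ | ∃ (μ : Fin K → ℝ) (S : Matrix (Fin r) (Fin r) ℝ),
        (∀ k, 0 ≤ μ k) ∧ (∑ k, μ k = 1) ∧ S.PosSemidef ∧
        S * S = (∑ k, μ k • A k)ᵀ * (∑ k, μ k • A k) ∧
        w = 2 * S.trace + ∑ k, μ k * c k} with hD
  have weak : ∀ v ∈ P, ∀ w ∈ D, v ≤ w := by
    rintro v ⟨U, hU, rfl⟩ w ⟨μ, S, hμ, hμ1, hS, hSM, rfl⟩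
    calc (⨅ k : Fin K, (2 * ((A k)ᵀ * U).trace + c k))
        = ∑ j, μ j * ⨅ k : Fin K, (2 * ((A k)ᵀ * U).trace + c k) := by
          rw [← Finset.sum_mul, hμ1, one_mul]
      _ ≤ ∑ j, μ j * (2 * ((A j)ᵀ * U).trace + c j) :=
          Finset.sum_le_sum fun j _ =>
            mul_le_mul_of_nonneg_left (ciInf_le (Set.finite_range _).bddBelow j) (hμ j)
      _ = 2 * ((∑ k, μ k • A k)ᵀ * U).trace + ∑ k, μ k * c k := sum_mul_trace_add A c μ U
      _ ≤ 2 * S.trace + ∑ k, μ k * c k := by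
          gcongr
          exact trace_transpose_mul_le_trace_of_contraction hS hSM hU
  have hPne : P.Nonempty := ⟨_, 0, by simpa using Matrix.PosSemidef.one, rfl⟩
  have hDne : D.Nonempty := by
    obtain ⟨S, hS, hSM⟩ :=
      exists_posSemidef_mul_self_eq (∑ k, (Pi.single ⟨0, hK⟩ 1 : Fin K → ℝ) k • A k)
    refine ⟨_, Pi.single ⟨0, hK⟩ 1, S, fun k => ?_, by simp, hS, hSM, rfl⟩
    rw [Pi.single_apply]; split_ifs <;> norm_num
  obtain ⟨w₀, hw₀⟩ := hDne
  have hPbdd : BddAbove P := ⟨w₀, fun v hv => weak v hv w₀ hw₀⟩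
  obtain ⟨v₀, hv₀⟩ := hPne
  have hDbdd : BddBelow D := ⟨v₀, fun w hw => weak v₀ hv₀ w hw⟩
  refine le_antisymm (csSup_le ⟨v₀, hv₀⟩ fun v hv => le_csInf ⟨w₀, hw₀⟩ (weak v hv)) ?_
  set F : Matrix (Fin n) (Fin r) ℝ → Fin K → ℝ := fun U k => 2 * ((A k)ᵀ * U).trace + c k with hF
  have himg : Convex ℝ (F '' {U | (1 - Uᵀ * U).PosSemidef}) := by
    rintro _ ⟨U, hU, rfl⟩ _ ⟨V, hV, rfl⟩ a b ha hb hab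
    refine ⟨a • U + b • V, convex_setOf_contraction hU hV ha hb hab, ?_⟩
    ext k
    simp only [hF, Pi.add_apply, Pi.smul_apply, smul_eq_mul, Matrix.mul_add, Matrix.mul_smul,
      Matrix.trace_add, Matrix.trace_smul]
    linear_combination (-c k) * hab
  obtain ⟨μ, hμ, hμ1, hle⟩ := himg.exists_simplex_sum_mul_le (v := sSup P)
    ⟨_, 0, by simpa using Matrix.PosSemidef.one, rfl⟩ (by
      rintro _ ⟨U, hU, rfl⟩
      obtain ⟨k, hk⟩ := exists_eq_ciInf_of_finite (f := F U)
      exact ⟨k, hk.le.trans (le_csSup hPbdd ⟨U, hU, rfl⟩)⟩)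
  obtain ⟨S, hS, hSM⟩ := exists_posSemidef_mul_self_eq (∑ k, μ k • A k)
  refine (csInf_le hDbdd ⟨μ, S, hμ, hμ1, hS, hSM, rfl⟩).trans ?_
  refine le_of_forall_pos_le_add fun δ hδ => ?_
  obtain ⟨U, hU, htr⟩ := exists_contraction_trace_sub_lt hS hSM (half_pos hδ)
  have h := hle _ ⟨U, hU, rfl⟩
  rw [hF, sum_mul_trace_add] at h
  linarith
end
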